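/- Completeness of normal order evaluation: for φ-terms t, s, if s is a normal form of t (i.e., t ⇝* s and s is in normal form) then t ⇝ℓ* s, where ⇝ℓ* is the reflexive-transitive closure of normal order reduction. -/

import Mathlib

namespace PhiCalc

/-- φ-terms over a set of attribute labels `L`. An object term carries a finite
list of attributes: `(a, none)` is a void attribute, `(b, some t)` is an
attached attribute. -/
inductive Tm (L : Type) : Type where
  | loc : Nat → Tm L
  | dot : Tm L → L → Tm L
  | app : Tm L → L → Tm L → Tm L
  | obj : List (L × Option (Tm L)) → Tm L

namespace Tm

variable {L : Type}

/-- Look up a label among the attributes of an object: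
`none` = the label is missing, `some none` = void attribute,
`some (some t)` = attribute attached to `t`. -/
def lookupAttr [DecidableEq L] (a : L) : List (L × Option (Tm L)) → Option (Option (Tm L))
  | [] => none
  | (b, o) :: rest => if a = b then some o else lookupAttr a rest

/-- Attach term `u` to the (first occurrence of) label `a`. -/
def attachAttr [DecidableEq L] (a : L) (u : Tm L) :
    List (L × Option (Tm L)) → List (L × Option (Tm L))
  | [] => []
  | (b, o) :: rest => if a = b then (b, some u) :: rest else (b, o) :: attachAttr a u rest

mutual
/-- Locator increment `↑ₙ t`. -/
def incAt : Nat → Tm L → Tm L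
  | n, loc m => if m < n then loc m else loc (m + 1)
  | n, dot t a => dot (incAt n t) a
  | n, app t a u => app (incAt n t) a (incAt n u)
  | n, obj attrs => obj (incAtList (n + 1) attrs)

def incAtList : Nat → List (L × Option (Tm L)) → List (L × Option (Tm L))
  | _, [] => []
  | n, (a, none) :: rest => (a, none) :: incAtList n rest
  | n, (a, some t) :: rest => (a, some (incAt n t)) :: incAtList n rest
end

mutual
/-- Locator substitution `t[ρ^n ↦ u]`. -/
def subst : Tm L → Nat → Tm L → Tm L
  | loc m, n, u => if m < n then loc m else if m = n then u else loc (m - 1)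
  | dot t a, n, u => dot (subst t n u) a
  | app t a v, n, u => app (subst t n u) a (subst v n u)
  | obj attrs, n, u => obj (substList attrs (n + 1) (incAt 0 u))

def substList : List (L × Option (Tm L)) → Nat → Tm L → List (L × Option (Tm L))
  | [], _, _ => []
  | (a, none) :: rest, n, u => (a, none) :: substList rest n u
  | (a, some t) :: rest, n, u => (a, some (subst t n u)) :: substList rest n u
end

section Reductions

variable [DecidableEq L]

/-- One-step (regular) reduction `⇝`, parametrized by the decorator label `phi`. -/
inductive Step (phi : L) : Tm L → Tm L → Prop where
  | congObj {t t' : Tm L} (pre post : List (L × Option (Tm L))) (b : L) :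
      Step phi t t' →
      Step phi (obj (pre ++ (b, some t) :: post)) (obj (pre ++ (b, some t') :: post))
  | congDot {t t' : Tm L} (a : L) : Step phi t t' → Step phi (dot t a) (dot t' a)
  | congAppL {t t' u : Tm L} (a : L) : Step phi t t' → Step phi (app t a u) (app t' a u)
  | congAppR {t u u' : Tm L} (a : L) : Step phi u u' → Step phi (app t a u) (app t a u')
  | dotStep {attrs : List (L × Option (Tm L))} {c : L} {tc : Tm L} :
      lookupAttr c attrs = some (some tc) →
      Step phi (dot (obj attrs) c) (subst tc 0 (obj attrs))
  | dotPhi {attrs : List (L × Option (Tm L))} {c : L} :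
      lookupAttr c attrs = none → (lookupAttr phi attrs).isSome →
      Step phi (dot (obj attrs) c) (dot (dot (obj attrs) phi) c)
  | appStep {attrs : List (L × Option (Tm L))} {c : L} {u : Tm L} :
      lookupAttr c attrs = some none →
      Step phi (app (obj attrs) c u) (obj (attachAttr c (incAt 0 u) attrs))

mutual
/-- Parallel reduction `⇛`. -/
inductive Par (phi : L) : Tm L → Tm L → Prop where
  | loc (n : Nat) : Par phi (Tm.loc n) (Tm.loc n)
  | obj {attrs attrs' : List (L × Option (Tm L))} :
      ParAttrs phi attrs attrs' → Par phi (Tm.obj attrs) (Tm.obj attrs')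
  | congDot {t t' : Tm L} (a : L) : Par phi t t' → Par phi (Tm.dot t a) (Tm.dot t' a)
  | congApp {t t' u u' : Tm L} (a : L) :
      Par phi t t' → Par phi u u' → Par phi (Tm.app t a u) (Tm.app t' a u')
  | dotPar {t : Tm L} {attrs : List (L × Option (Tm L))} {c : L} {tc : Tm L} :
      Par phi t (Tm.obj attrs) → lookupAttr c attrs = some (some tc) →
      Par phi (Tm.dot t c) (subst tc 0 (Tm.obj attrs))
  | dotPhi {t : Tm L} {attrs : List (L × Option (Tm L))} {c : L} :
      Par phi t (Tm.obj attrs) → lookupAttr c attrs = none →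
      (lookupAttr phi attrs).isSome →
      Par phi (Tm.dot t c) (Tm.dot (Tm.dot (Tm.obj attrs) phi) c)
  | appPar {t : Tm L} {attrs : List (L × Option (Tm L))} {c : L} {u u' : Tm L} :
      Par phi t (Tm.obj attrs) → lookupAttr c attrs = some none → Par phi u u' →
      Par phi (Tm.app t c u) (Tm.obj (attachAttr c (incAt 0 u') attrs))

/-- Pointwise parallel reduction on attribute lists: void attributes are kept,
attached attributes reduce in parallel. -/
inductive ParAttrs (phi : L) :
    List (L × Option (Tm L)) → List (L × Option (Tm L)) → Prop where
  | nil : ParAttrs phi [] []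
  | void {rest rest' : List (L × Option (Tm L))} (a : L) :
      ParAttrs phi rest rest' → ParAttrs phi ((a, none) :: rest) ((a, none) :: rest')
  | attached {t t' : Tm L} {rest rest' : List (L × Option (Tm L))} (a : L) :
      Par phi t t' → ParAttrs phi rest rest' →
      ParAttrs phi ((a, some t) :: rest) ((a, some t') :: rest')
end

/-- Head reduction `→h`. -/
inductive Head (phi : L) : Tm L → Tm L → Prop where
  | dotStep {attrs : List (L × Option (Tm L))} {c : L} {tc : Tm L} :
      lookupAttr c attrs = some (some tc) →
      Head phi (dot (obj attrs) c) (subst tc 0 (obj attrs))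
  | dotPhi {attrs : List (L × Option (Tm L))} {c : L} :
      lookupAttr c attrs = none → (lookupAttr phi attrs).isSome →
      Head phi (dot (obj attrs) c) (dot (dot (obj attrs) phi) c)
  | appStep {attrs : List (L × Option (Tm L))} {c : L} {u : Tm L} :
      lookupAttr c attrs = some none →
      Head phi (app (obj attrs) c u) (obj (attachAttr c (incAt 0 u) attrs))
  | congDot {t t' : Tm L} (a : L) : Head phi t t' → Head phi (dot t a) (dot t' a)
  | congApp {t t' u : Tm L} (a : L) : Head phi t t' → Head phi (app t a u) (app t' a u)

/-- Internal parallel reduction `⇛ᵢ`. -/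
inductive ParI (phi : L) : Tm L → Tm L → Prop where
  | loc (n : Nat) : ParI phi (Tm.loc n) (Tm.loc n)
  | obj {attrs attrs' : List (L × Option (Tm L))} :
      ParAttrs phi attrs attrs' → ParI phi (Tm.obj attrs) (Tm.obj attrs')
  | congDot {t t' : Tm L} (a : L) : ParI phi t t' → ParI phi (Tm.dot t a) (Tm.dot t' a)
  | congApp {t t' u u' : Tm L} (a : L) :
      ParI phi t t' → Par phi u u' → ParI phi (Tm.app t a u) (Tm.app t' a u')

/-- Internal (regular) reduction `→ᵢ`. -/
inductive StepI (phi : L) : Tm L → Tm L → Prop where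
  | congObj {t t' : Tm L} (pre post : List (L × Option (Tm L))) (b : L) :
      Step phi t t' →
      StepI phi (obj (pre ++ (b, some t) :: post)) (obj (pre ++ (b, some t') :: post))
  | congDot {t t' : Tm L} (a : L) : StepI phi t t' → StepI phi (dot t a) (dot t' a)
  | congAppL {t t' u : Tm L} (a : L) : StepI phi t t' → StepI phi (app t a u) (app t' a u)
  | congAppR {t u u' : Tm L} (a : L) : Step phi u u' → StepI phi (app t a u) (app t a u')

end Reductions

end Tm

end PhiCalc
namespace PhiCalc
namespace Tm
section Extra
variable {L : Type} [DecidableEq L]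

mutual
/-- Complete development `t⁺`. -/
def cd (phi : L) : Tm L → Tm L
  | loc n => loc n
  | dot t a =>
    match cd phi t with
    | obj attrs =>
      match lookupAttr a attrs with
      | some (some ta) => subst ta 0 (obj attrs)
      | some none => dot (obj attrs) a
      | none =>
        if (lookupAttr phi attrs).isSome then dot (dot (obj attrs) phi) a
        else dot (obj attrs) a
    | t' => dot t' a
  | app t a u =>
    match cd phi t with
    | obj attrs =>
      match lookupAttr a attrs with
      | some none => obj (attachAttr a (incAt 0 (cd phi u)) attrs)
      | _ => app (obj attrs) a (cd phi u)
    | t' => app t' a (cd phi u)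
  | obj attrs => obj (cdList phi attrs)

def cdList (phi : L) : List (L × Option (Tm L)) → List (L × Option (Tm L))
  | [] => []
  | (a, none) :: rest => (a, none) :: cdList phi rest
  | (a, some t) :: rest => (a, some (cd phi t)) :: cdList phi rest
end

/-- Head reduction as a (deterministic) partial function. -/
def headRed (phi : L) : Tm L → Option (Tm L)
  | loc _ => none
  | obj _ => none
  | dot t a =>
    match t with
    | obj attrs =>
      match lookupAttr a attrs with
      | some (some ta) => some (subst ta 0 (obj attrs))
      | some none => none
      | none =>
        if (lookupAttr phi attrs).isSome then some (dot (dot (obj attrs) phi) a)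
        else none
    | t => (headRed phi t).map (fun t' => dot t' a)
  | app t a u =>
    match t with
    | obj attrs =>
      match lookupAttr a attrs with
      | some none => some (obj (attachAttr a (incAt 0 u) attrs))
      | _ => none
    | t => (headRed phi t).map (fun t' => app t' a u)

mutual
/-- Normal order reduction `⇝ℓ` as a (deterministic) partial function:
head reduction first, otherwise reduce the leftmost subterm that reduces. -/
def nordRed (phi : L) : Tm L → Option (Tm L)
  | loc _ => none
  | dot t a =>
    match headRed phi (dot t a) with
    | some s => some s
    | none => (nordRed phi t).map (fun t' => dot t' a)
  | app t a u =>
    match headRed phi (app t a u) with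
    | some s => some s
    | none =>
      match nordRed phi t with
      | some t' => some (app t' a u)
      | none => (nordRed phi u).map (fun u' => app t a u')
  | obj attrs => (nordList phi attrs).map obj

def nordList (phi : L) : List (L × Option (Tm L)) → Option (List (L × Option (Tm L)))
  | [] => none
  | (a, none) :: rest => (nordList phi rest).map (fun rest' => (a, none) :: rest')
  | (a, some t) :: rest =>
    match nordRed phi t with
    | some t' => some ((a, some t') :: rest)
    | none => (nordList phi rest).map (fun rest' => (a, some t) :: rest')
end

/-- Normal order reduction relation. -/
def NOrd (phi : L) (t t' : Tm L) : Prop := nordRed phi t = some t'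

end Extra
end Tm
end PhiCalc
namespace PhiCalc
namespace Tm
section Standardization
variable {L : Type}

/-! ### Commutation of locator increment and substitution -/

mutual
theorem incAt_incAt : ∀ (t : Tm L) {k n : Nat}, k ≤ n →
    incAt (n + 1) (incAt k t) = incAt k (incAt n t)
  | loc m, k, n, h => by
    simp only [incAt]
    split_ifs <;> simp only [incAt] <;> split_ifs <;> first | rfl | omega
  | dot t a, k, n, h => by simp only [incAt, incAt_incAt t h]
  | app t a u, k, n, h => by simp only [incAt, incAt_incAt t h, incAt_incAt u h]
  | obj l, k, n, h => by simp only [incAt, incAtList_incAtList l (Nat.succ_le_succ h)]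

theorem incAtList_incAtList : ∀ (l : List (L × Option (Tm L))) {k n : Nat}, k ≤ n →
    incAtList (n + 1) (incAtList k l) = incAtList k (incAtList n l)
  | [], _, _, _ => by simp only [incAtList]
  | (a, none) :: l, _, _, h => by simp only [incAtList, incAtList_incAtList l h]
  | (a, some t) :: l, _, _, h => by
    simp only [incAtList, incAt_incAt t h, incAtList_incAtList l h]
end

mutual
theorem incAt_subst_of_ge : ∀ (t : Tm L) {k n : Nat} (u : Tm L), k ≤ n →
    incAt n (subst t k u) = subst (incAt (n + 1) t) k (incAt n u)
  | loc m, k, n, u, h => by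
    simp only [incAt, subst]
    split_ifs <;> simp only [incAt, subst] <;> split_ifs <;>
      first | rfl | omega | (congr 1; omega)
  | dot t a, k, n, u, h => by simp only [incAt, subst, incAt_subst_of_ge t u h]
  | app t a v, k, n, u, h => by
    simp only [incAt, subst, incAt_subst_of_ge t u h, incAt_subst_of_ge v u h]
  | obj l, k, n, u, h => by
    simp only [incAt, subst, incAtList_substList_of_ge l _ (Nat.succ_le_succ h),
      incAt_incAt u (Nat.zero_le n)]

theorem incAtList_substList_of_ge : ∀ (l : List (L × Option (Tm L))) {k n : Nat} (u : Tm L),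
    k ≤ n → incAtList n (substList l k u) = substList (incAtList (n + 1) l) k (incAt n u)
  | [], _, _, _, _ => by simp only [incAtList, substList]
  | (a, none) :: l, _, _, u, h => by
    simp only [incAtList, substList, incAtList_substList_of_ge l u h]
  | (a, some t) :: l, _, _, u, h => by
    simp only [incAtList, substList, incAt_subst_of_ge t u h, incAtList_substList_of_ge l u h]
end

mutual
theorem incAt_subst_of_le : ∀ (t : Tm L) {k n : Nat} (u : Tm L), k ≤ n →
    incAt k (subst t n u) = subst (incAt k t) (n + 1) (incAt k u)
  | loc m, k, n, u, h => by
    simp only [incAt, subst]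
    split_ifs <;> simp only [incAt, subst] <;> split_ifs <;>
      first | rfl | omega | (congr 1; omega)
  | dot t a, k, n, u, h => by simp only [incAt, subst, incAt_subst_of_le t u h]
  | app t a v, k, n, u, h => by
    simp only [incAt, subst, incAt_subst_of_le t u h, incAt_subst_of_le v u h]
  | obj l, k, n, u, h => by
    simp only [incAt, subst, incAtList_substList_of_le l _ (Nat.succ_le_succ h),
      incAt_incAt u (Nat.zero_le k)]

theorem incAtList_substList_of_le : ∀ (l : List (L × Option (Tm L))) {k n : Nat} (u : Tm L),
    k ≤ n → incAtList k (substList l n u) = substList (incAtList k l) (n + 1) (incAt k u)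
  | [], _, _, _, _ => by simp only [incAtList, substList]
  | (a, none) :: l, _, _, u, h => by
    simp only [incAtList, substList, incAtList_substList_of_le l u h]
  | (a, some t) :: l, _, _, u, h => by
    simp only [incAtList, substList, incAt_subst_of_le t u h, incAtList_substList_of_le l u h]
end

mutual
theorem subst_incAt : ∀ (t : Tm L) (n : Nat) (u : Tm L), subst (incAt n t) n u = t
  | loc m, n, u => by
    simp only [incAt]
    split_ifs <;> simp only [subst] <;> split_ifs <;> first | rfl | omega
  | dot t a, n, u => by simp only [incAt, subst, subst_incAt t]
  | app t a v, n, u => by simp only [incAt, subst, subst_incAt t, subst_incAt v]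
  | obj l, n, u => by simp only [incAt, subst, substList_incAtList l]

theorem substList_incAtList : ∀ (l : List (L × Option (Tm L))) (n : Nat) (u : Tm L),
    substList (incAtList n l) n u = l
  | [], _, _ => by simp only [incAtList, substList]
  | (a, none) :: l, _, _ => by simp only [incAtList, substList, substList_incAtList l]
  | (a, some t) :: l, _, _ => by
    simp only [incAtList, substList, subst_incAt t, substList_incAtList l]
end

mutual
theorem subst_subst : ∀ (t : Tm L) {k n : Nat} (v u : Tm L), k ≤ n →
    subst (subst t k v) n u = subst (subst t (n + 1) (incAt k u)) k (subst v n u)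
  | loc m, k, n, v, u, h => by
    simp only [subst]
    split_ifs <;> simp only [subst, subst_incAt] <;>
      first | omega | rfl | (split_ifs <;> first | rfl | omega)
  | dot t a, k, n, v, u, h => by simp only [subst, subst_subst t v u h]
  | app t a w, k, n, v, u, h => by
    simp only [subst, subst_subst t v u h, subst_subst w v u h]
  | obj l, k, n, v, u, h => by
    simp only [subst, substList_substList l _ _ (Nat.succ_le_succ h),
      incAt_incAt u (Nat.zero_le k), incAt_subst_of_le v u (Nat.zero_le n)]

theorem substList_substList : ∀ (l : List (L × Option (Tm L))) {k n : Nat} (v u : Tm L),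
    k ≤ n → substList (substList l k v) n u =
      substList (substList l (n + 1) (incAt k u)) k (subst v n u)
  | [], _, _, _, _, _ => by simp only [substList]
  | (a, none) :: l, _, _, v, u, h => by simp only [substList, substList_substList l v u h]
  | (a, some t) :: l, _, _, v, u, h => by
    simp only [substList, subst_subst t v u h, substList_substList l v u h]
end

variable [DecidableEq L]

theorem lookupAttr_incAtList (c : L) (n : Nat) : ∀ l : List (L × Option (Tm L)),
    lookupAttr c (incAtList n l) = (lookupAttr c l).map (Option.map (incAt n))
  | [] => by simp [incAtList, lookupAttr]
  | (a, none) :: l => by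
    simp only [incAtList, lookupAttr, lookupAttr_incAtList c n l]; split_ifs <;> rfl
  | (a, some t) :: l => by
    simp only [incAtList, lookupAttr, lookupAttr_incAtList c n l]; split_ifs <;> rfl

theorem lookupAttr_substList (c : L) (n : Nat) (u : Tm L) : ∀ l : List (L × Option (Tm L)),
    lookupAttr c (substList l n u) =
      (lookupAttr c l).map (Option.map (fun t => subst t n u))
  | [] => by simp [substList, lookupAttr]
  | (a, none) :: l => by
    simp only [substList, lookupAttr, lookupAttr_substList c n u l]; split_ifs <;> rfl
  | (a, some t) :: l => by
    simp only [substList, lookupAttr, lookupAttr_substList c n u l]; split_ifs <;> rfl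

theorem incAtList_attachAttr (c : L) (n : Nat) (v : Tm L) : ∀ l : List (L × Option (Tm L)),
    incAtList n (attachAttr c v l) = attachAttr c (incAt n v) (incAtList n l)
  | [] => by simp [incAtList, attachAttr]
  | (a, none) :: l => by
    simp only [incAtList, attachAttr]
    split_ifs <;> simp only [incAtList, incAtList_attachAttr c n v l]
  | (a, some t) :: l => by
    simp only [incAtList, attachAttr]
    split_ifs <;> simp only [incAtList, incAtList_attachAttr c n v l]

theorem substList_attachAttr (c : L) (n : Nat) (u v : Tm L) :
    ∀ l : List (L × Option (Tm L)),
      substList (attachAttr c v l) n u = attachAttr c (subst v n u) (substList l n u)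
  | [] => by simp [substList, attachAttr]
  | (a, none) :: l => by
    simp only [substList, attachAttr]
    split_ifs <;> simp only [substList, substList_attachAttr c n u v l]
  | (a, some t) :: l => by
    simp only [substList, attachAttr]
    split_ifs <;> simp only [substList, substList_attachAttr c n u v l]

/-! ### Head reduction is stable under increment and substitution -/

variable {phi : L}

theorem Head.incAt {t t' : Tm L} (h : Head phi t t') (n : Nat) :
    Head phi (incAt n t) (incAt n t') := by
  induction h with
  | dotStep h =>
    rw [incAt_subst_of_ge _ _ (Nat.zero_le n)]
    simp only [Tm.incAt]
    exact .dotStep (by simp [lookupAttr_incAtList, h])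
  | dotPhi h h' =>
    simp only [Tm.incAt]
    exact .dotPhi (by simp [lookupAttr_incAtList, h]) (by simpa [lookupAttr_incAtList] using h')
  | appStep h =>
    simp only [Tm.incAt, incAtList_attachAttr, incAt_incAt _ (Nat.zero_le n)]
    exact .appStep (by simp [lookupAttr_incAtList, h])
  | congDot a _ ih => simp only [Tm.incAt]; exact .congDot a ih
  | congApp a _ ih => simp only [Tm.incAt]; exact .congApp a ih

theorem Head.subst {t t' : Tm L} (h : Head phi t t') (n : Nat) (u : Tm L) :
    Head phi (subst t n u) (subst t' n u) := by
  induction h with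
  | dotStep h =>
    rw [subst_subst _ _ _ (Nat.zero_le n)]
    simp only [Tm.subst]
    exact .dotStep (by simp [lookupAttr_substList, h])
  | dotPhi h h' =>
    simp only [Tm.subst]
    exact .dotPhi (by simp [lookupAttr_substList, h]) (by simpa [lookupAttr_substList] using h')
  | appStep h =>
    simp only [Tm.subst, substList_attachAttr, ← incAt_subst_of_le _ _ (Nat.zero_le n)]
    exact .appStep (by simp [lookupAttr_substList, h])
  | congDot a _ ih => simp only [Tm.subst]; exact .congDot a ih
  | congApp a _ ih => simp only [Tm.subst]; exact .congApp a ih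

open Relation

/-! ### Standard reduction -/

mutual
/-- Standard reduction: head-reduce to a term with the root constructor of the target,
then reduce the immediate subterms by standard reductions. -/
inductive Std (phi : L) : Tm L → Tm L → Prop where
  | loc {t : Tm L} {n : Nat} : ReflTransGen (Head phi) t (loc n) → Std phi t (loc n)
  | dot {t t₁ s₁ : Tm L} {a : L} :
      ReflTransGen (Head phi) t (dot t₁ a) → Std phi t₁ s₁ → Std phi t (dot s₁ a)
  | app {t t₁ u₁ s₁ v₁ : Tm L} {a : L} :
      ReflTransGen (Head phi) t (app t₁ a u₁) → Std phi t₁ s₁ → Std phi u₁ v₁ →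
      Std phi t (app s₁ a v₁)
  | obj {t : Tm L} {l l' : List (L × Option (Tm L))} :
      ReflTransGen (Head phi) t (obj l) → StdAttrs phi l l' → Std phi t (obj l')

/-- Pointwise standard reduction on attribute lists. -/
inductive StdAttrs (phi : L) :
    List (L × Option (Tm L)) → List (L × Option (Tm L)) → Prop where
  | nil : StdAttrs phi [] []
  | void {l l' : List (L × Option (Tm L))} (a : L) :
      StdAttrs phi l l' → StdAttrs phi ((a, none) :: l) ((a, none) :: l')
  | attached {t t' : Tm L} {l l' : List (L × Option (Tm L))} (a : L) :
      Std phi t t' → StdAttrs phi l l' → StdAttrs phi ((a, some t) :: l) ((a, some t') :: l')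
end

mutual
theorem Std.refl : ∀ t : Tm L, Std phi t t
  | Tm.loc _ => .loc .refl
  | Tm.dot t _ => .dot .refl (Std.refl t)
  | Tm.app t _ u => .app .refl (Std.refl t) (Std.refl u)
  | Tm.obj l => .obj .refl (StdAttrs.refl l)

theorem StdAttrs.refl : ∀ l : List (L × Option (Tm L)), StdAttrs phi l l
  | [] => .nil
  | (a, none) :: l => .void a (StdAttrs.refl l)
  | (a, some t) :: l => .attached a (Std.refl t) (StdAttrs.refl l)
end

theorem Std.head_trans {r t s : Tm L} (h : ReflTransGen (Head phi) r t) (hs : Std phi t s) :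
    Std phi r s := by
  cases hs with
  | loc h' => exact .loc (h.trans h')
  | dot h' h₁ => exact .dot (h.trans h') h₁
  | app h' h₁ h₂ => exact .app (h.trans h') h₁ h₂
  | obj h' h₁ => exact .obj (h.trans h') h₁

mutual
theorem Std.incAt : ∀ {t s : Tm L}, Std phi t s → ∀ n, Std phi (incAt n t) (incAt n s)
  | _, _, .loc h, n => .head_trans (h.lift (Tm.incAt n) fun _ _ h => h.incAt n) (.refl _)
  | _, _, .dot h h₁, n => by
    have := h.lift (Tm.incAt n) fun _ _ h => h.incAt n
    simp only [Tm.incAt] at this ⊢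
    exact .dot this (h₁.incAt n)
  | _, _, .app h h₁ h₂, n => by
    have := h.lift (Tm.incAt n) fun _ _ h => h.incAt n
    simp only [Tm.incAt] at this ⊢
    exact .app this (h₁.incAt n) (h₂.incAt n)
  | _, _, .obj h h₁, n => by
    have := h.lift (Tm.incAt n) fun _ _ h => h.incAt n
    simp only [Tm.incAt] at this ⊢
    exact .obj this (h₁.incAtList (n + 1))

theorem StdAttrs.incAtList : ∀ {l l' : List (L × Option (Tm L))}, StdAttrs phi l l' →
    ∀ n, StdAttrs phi (incAtList n l) (incAtList n l')
  | _, _, .nil, _ => .refl _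
  | _, _, .void a h, n => by simp only [Tm.incAtList]; exact .void a (h.incAtList n)
  | _, _, .attached a h₁ h, n => by
    simp only [Tm.incAtList]; exact .attached a (h₁.incAt n) (h.incAtList n)
end

mutual
theorem Std.subst : ∀ {t s : Tm L}, Std phi t s → ∀ (n : Nat) {u v : Tm L}, Std phi u v →
    Std phi (subst t n u) (subst s n v)
  | _, _, .loc (n := m) h, n, u, v, hu => by
    refine .head_trans (h.lift (Tm.subst · n u) fun _ _ h => h.subst n u) ?_
    simp only [Tm.subst]
    split_ifs
    exacts [.refl _, hu, .refl _]
  | _, _, .dot h h₁, n, u, v, hu => by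
    have := h.lift (Tm.subst · n u) fun _ _ h => h.subst n u
    simp only [Tm.subst] at this ⊢
    exact .dot this (h₁.subst n hu)
  | _, _, .app h h₁ h₂, n, u, v, hu => by
    have := h.lift (Tm.subst · n u) fun _ _ h => h.subst n u
    simp only [Tm.subst] at this ⊢
    exact .app this (h₁.subst n hu) (h₂.subst n hu)
  | _, _, .obj h h₁, n, u, v, hu => by
    have := h.lift (Tm.subst · n u) fun _ _ h => h.subst n u
    simp only [Tm.subst] at this ⊢
    exact .obj this (h₁.substList (n + 1) (hu.incAt 0))

theorem StdAttrs.substList : ∀ {l l' : List (L × Option (Tm L))}, StdAttrs phi l l' →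
    ∀ (n : Nat) {u v : Tm L}, Std phi u v →
      StdAttrs phi (substList l n u) (substList l' n v)
  | _, _, .nil, _, _, _, _ => by simp only [Tm.substList]; exact .nil
  | _, _, .void a h, n, _, _, hu => by
    simp only [Tm.substList]; exact .void a (h.substList n hu)
  | _, _, .attached a h₁ h, n, _, _, hu => by
    simp only [Tm.substList]; exact .attached a (h₁.subst n hu) (h.substList n hu)
end

theorem StdAttrs.attachAttr {u v : Tm L} (hu : Std phi u v) (c : L) :
    ∀ {l l' : List (L × Option (Tm L))}, StdAttrs phi l l' →
      StdAttrs phi (attachAttr c u l) (attachAttr c v l')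
  | _, _, .nil => .refl _
  | _, _, .void a h => by
    simp only [Tm.attachAttr]
    split_ifs
    exacts [.attached a hu h, .void a (StdAttrs.attachAttr hu c h)]
  | _, _, .attached a h₁ h => by
    simp only [Tm.attachAttr]
    split_ifs
    exacts [.attached a hu h, .attached a h₁ (StdAttrs.attachAttr hu c h)]

theorem StdAttrs.lookupAttr_rel (c : L) : ∀ {l l' : List (L × Option (Tm L))},
    StdAttrs phi l l' →
      Option.Rel (Option.Rel (Std phi)) (lookupAttr c l) (lookupAttr c l')
  | _, _, .nil => by simp only [lookupAttr]; exact .none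
  | _, _, .void a h => by
    simp only [lookupAttr]
    split_ifs
    exacts [.some .none, h.lookupAttr_rel c]
  | _, _, .attached a h₁ h => by
    simp only [lookupAttr]
    split_ifs
    exacts [.some (.some h₁), h.lookupAttr_rel c]

theorem StdAttrs.replace {t t' : Tm L} (ht : ∀ r, Std phi r t → Std phi r t') (b : L)
    (post : List (L × Option (Tm L))) :
    ∀ (pre : List (L × Option (Tm L))) {l : List (L × Option (Tm L))},
      StdAttrs phi l (pre ++ (b, some t) :: post) →
      StdAttrs phi l (pre ++ (b, some t') :: post)
  | [], _, .attached _ h₁ h => .attached _ (ht _ h₁) h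
  | _ :: pre, _, .void a h => .void a (StdAttrs.replace ht b post pre h)
  | _ :: pre, _, .attached a h₁ h => .attached a h₁ (StdAttrs.replace ht b post pre h)

theorem Std.step {r t s : Tm L} (hr : Std phi r t) (h : Step phi t s) : Std phi r s := by
  induction h generalizing r with
  | congObj pre post b _ ih =>
    cases hr with
    | obj h h₁ => exact .obj h (h₁.replace (fun _ => ih) b post pre)
  | congDot a _ ih =>
    cases hr with
    | dot h h₁ => exact .dot h (ih h₁)
  | congAppL a _ ih =>
    cases hr with
    | app h h₁ h₂ => exact .app h (ih h₁) h₂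
  | congAppR a _ ih =>
    cases hr with
    | app h h₁ h₂ => exact .app h h₁ (ih h₂)
  | @dotStep attrs c tc hc =>
    cases hr with
    | dot h h₁ =>
      cases h₁ with
      | @obj _ l _ h' hl =>
        have hrel := hl.lookupAttr_rel c
        rw [hc] at hrel
        generalize hc' : lookupAttr c l = o at hrel
        cases hrel with
        | some hrel =>
          cases hrel with
          | some h₂ =>
            exact .head_trans ((h.trans (h'.lift (Tm.dot · c) fun _ _ => .congDot c)).tail
              (.dotStep hc')) (h₂.subst 0 (.obj .refl hl))
  | @dotPhi attrs c hc hp =>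
    cases hr with
    | dot h h₁ =>
      cases h₁ with
      | @obj _ l _ h' hl =>
        have hrel := hl.lookupAttr_rel c
        have hrelp := hl.lookupAttr_rel phi
        rw [hc] at hrel
        generalize hc' : lookupAttr c l = o at hrel
        cases hrel
        have hp' : (lookupAttr phi l).isSome := by
          revert hp hrelp
          cases lookupAttr phi l <;> cases lookupAttr phi attrs <;> simp
        exact .dot ((h.trans (h'.lift (Tm.dot · c) fun _ _ => .congDot c)).tail
          (.dotPhi hc' hp')) (.dot .refl (.obj .refl hl))
  | @appStep attrs c u hc =>
    cases hr with
    | app h h₁ h₂ =>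
      cases h₁ with
      | @obj _ l _ h' hl =>
        have hrel := hl.lookupAttr_rel c
        rw [hc] at hrel
        generalize hc' : lookupAttr c l = o at hrel
        cases hrel with
        | some hrel =>
          cases hrel
          exact .obj ((h.trans (h'.lift (Tm.app · c _) fun _ _ => .congApp c)).tail
            (.appStep hc')) (hl.attachAttr (h₂.incAt 0) c)

theorem Std.of_steps {t s : Tm L} (h : ReflTransGen (Step phi) t s) : Std phi t s := by
  induction h with
  | refl => exact .refl t
  | tail _ h ih => exact ih.step h

/-! ### Normal order reduction -/

theorem Head.headRed_eq {t t' : Tm L} (h : Head phi t t') : headRed phi t = some t' := by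
  induction h with
  | dotStep h => simp [headRed, h]
  | dotPhi h h' => simp [headRed, h, h']
  | appStep h => simp [headRed, h]
  | @congDot t t' a _ ih => cases t <;> simp_all [headRed]
  | @congApp t t' u a _ ih => cases t <;> simp_all [headRed]

theorem headRed_step {t s : Tm L} (h : headRed phi t = some s) : Step phi t s := by
  fun_induction headRed phi t generalizing s <;> simp at h
  all_goals first
    | (subst h; first | exact .dotStep ‹_› | exact .dotPhi ‹_› ‹_› | exact .appStep ‹_›)
    | (obtain ⟨t', h, rfl⟩ := h
       rename_i ih
       first | exact .congDot _ (ih h) | exact .congAppL _ (ih h))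

theorem nordRed_of_headRed {t s : Tm L} (h : headRed phi t = some s) :
    nordRed phi t = some s := by
  cases t with
  | loc => simp [headRed] at h
  | obj => simp [headRed] at h
  | dot => simp [nordRed, h]
  | app => simp [nordRed, h]

mutual
theorem nordRed_step : ∀ {t s : Tm L}, nordRed phi t = some s → Step phi t s
  | loc _, _, h => by simp [nordRed] at h
  | dot t a, s, h => by
    rw [nordRed] at h
    split at h
    next h' => cases h; exact headRed_step h'
    next =>
      obtain ⟨t', hr, rfl⟩ := Option.map_eq_some_iff.1 h
      exact .congDot a (nordRed_step hr)
  | app t a u, s, h => by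
    rw [nordRed] at h
    split at h
    next h' => cases h; exact headRed_step h'
    next =>
      split at h
      next h' => cases h; exact .congAppL a (nordRed_step h')
      next =>
        obtain ⟨u', hr, rfl⟩ := Option.map_eq_some_iff.1 h
        exact .congAppR a (nordRed_step hr)
  | obj l, s, h => by
    rw [nordRed] at h
    obtain ⟨l', hr, rfl⟩ := Option.map_eq_some_iff.1 h
    exact nordList_step [] hr

theorem nordList_step : ∀ {l l' : List (L × Option (Tm L))} (pre : List (L × Option (Tm L))),
    nordList phi l = some l' → Step phi (obj (pre ++ l)) (obj (pre ++ l'))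
  | [], _, _, h => by simp [nordList] at h
  | (a, none) :: l, _, pre, h => by
    rw [nordList] at h
    obtain ⟨l', hr, rfl⟩ := Option.map_eq_some_iff.1 h
    have := nordList_step (pre ++ [(a, none)]) hr
    rw [List.append_assoc, List.append_assoc] at this
    exact this
  | (a, some t) :: l, _, pre, h => by
    rw [nordList] at h
    split at h
    next h' => cases h; exact .congObj pre l a (nordRed_step h')
    next =>
      obtain ⟨l', hr, rfl⟩ := Option.map_eq_some_iff.1 h
      simpa using nordList_step (pre ++ [(a, some t)]) hr
end

theorem nordRed_eq_none {s : Tm L} (h : ∀ s', ¬ Step phi s s') : nordRed phi s = none :=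
  Option.eq_none_iff_forall_ne_some.2 fun s' hs => h s' (nordRed_step hs)

theorem headRed_eq_none {s : Tm L} (h : ∀ s', ¬ Step phi s s') : headRed phi s = none :=
  Option.eq_none_iff_forall_ne_some.2 fun s' hs => h s' (headRed_step hs)

theorem lookupAttr_nordList (c : L) : ∀ {l l' : List (L × Option (Tm L))},
    nordList phi l = some l' →
      (lookupAttr c l).map Option.isSome = (lookupAttr c l').map Option.isSome
  | [], _, h => by simp [nordList] at h
  | (a, none) :: l, _, h => by
    rw [nordList] at h
    obtain ⟨l', hr, rfl⟩ := Option.map_eq_some_iff.1 h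
    simp only [lookupAttr]
    split_ifs
    exacts [rfl, lookupAttr_nordList c hr]
  | (a, some t) :: l, _, h => by
    rw [nordList] at h
    split at h
    next =>
      cases h
      simp only [lookupAttr]
      split_ifs <;> rfl
    next =>
      obtain ⟨l', hr, rfl⟩ := Option.map_eq_some_iff.1 h
      simp only [lookupAttr]
      split_ifs
      exacts [rfl, lookupAttr_nordList c hr]

theorem exists_obj_of_nOrd_obj {l : List (L × Option (Tm L))} {s : Tm L}
    (h : ReflTransGen (NOrd phi) (obj l) s) :
    ∃ l', s = obj l' ∧
      ∀ c, (lookupAttr c l).map Option.isSome = (lookupAttr c l').map Option.isSome := by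
  induction h with
  | refl => exact ⟨l, rfl, fun _ => rfl⟩
  | tail _ h ih =>
    obtain ⟨l₁, rfl, h₁⟩ := ih
    rw [NOrd, nordRed] at h
    obtain ⟨l', hr, rfl⟩ := Option.map_eq_some_iff.1 h
    exact ⟨l', rfl, fun c => (h₁ c).trans (lookupAttr_nordList c hr)⟩

theorem headRed_dot_obj_isSome (l : List (L × Option (Tm L))) (a : L) :
    (headRed phi (dot (obj l) a)).isSome =
      (((lookupAttr a l).map Option.isSome).getD
        ((lookupAttr phi l).map Option.isSome).isSome) := by
  rcases h : lookupAttr a l with - | (- | t) <;> simp [headRed, h]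
  split_ifs with hp <;> simp [hp]

theorem headRed_app_obj_isSome (l : List (L × Option (Tm L))) (a : L) (u : Tm L) :
    (headRed phi (app (obj l) a u)).isSome =
      (((lookupAttr a l).map Option.isSome) == some false) := by
  rcases h : lookupAttr a l with - | (- | t) <;> simp [headRed, h]

theorem nOrd_dot {t t' : Tm L} {a : L} (h : NOrd phi t t')
    (ht : ∀ l, t = obj l → headRed phi (dot t a) = none) :
    NOrd phi (dot t a) (dot t' a) := by
  have key : headRed phi (dot t a) = none ∨
      headRed phi (dot t a) = (headRed phi t).map (dot · a) := by
    cases t <;> first | exact .inl (ht _ rfl) | (right; simp only [headRed])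
  rw [NOrd] at h ⊢
  rw [nordRed, h]
  rcases key with key | key <;> rw [key]
  · rfl
  · rcases h' : headRed phi t with - | t''
    · rfl
    · cases h.symm.trans (nordRed_of_headRed h')
      rfl

theorem nOrd_app {t t' u : Tm L} {a : L} (h : NOrd phi t t')
    (ht : ∀ l, t = obj l → headRed phi (app t a u) = none) :
    NOrd phi (app t a u) (app t' a u) := by
  have key : headRed phi (app t a u) = none ∨
      headRed phi (app t a u) = (headRed phi t).map (app · a u) := by
    cases t <;> first | exact .inl (ht _ rfl) | (right; simp only [headRed])
  rw [NOrd] at h ⊢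
  rw [nordRed, h]
  rcases key with key | key
  · rw [key]
  · rw [key]
    rcases h' : headRed phi t with - | t''
    · rfl
    · cases h.symm.trans (nordRed_of_headRed h')
      rfl

theorem nOrds_dot {t s : Tm L} {a : L} (h : ReflTransGen (NOrd phi) t s)
    (hs : headRed phi (dot s a) = none) :
    ReflTransGen (NOrd phi) (dot t a) (dot s a) := by
  induction h using ReflTransGen.head_induction_on with
  | refl => exact .refl
  | head h h' ih =>
    refine .head (nOrd_dot h ?_) ih
    rintro l rfl
    obtain ⟨l', rfl, hl⟩ := exists_obj_of_nOrd_obj (h'.head h)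
    rw [← Option.not_isSome_iff_eq_none, headRed_dot_obj_isSome] at hs ⊢
    rwa [hl a, hl phi]

theorem nOrds_app {t s u : Tm L} {a : L} (h : ReflTransGen (NOrd phi) t s)
    (hs : headRed phi (app s a u) = none) :
    ReflTransGen (NOrd phi) (app t a u) (app s a u) := by
  induction h using ReflTransGen.head_induction_on with
  | refl => exact .refl
  | head h h' ih =>
    refine .head (nOrd_app h ?_) ih
    rintro l rfl
    obtain ⟨l', rfl, hl⟩ := exists_obj_of_nOrd_obj (h'.head h)
    rw [← Option.not_isSome_iff_eq_none, headRed_app_obj_isSome] at hs ⊢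
    rwa [hl a]

theorem headRed_app_eq_none_congr {s u v : Tm L} {a : L}
    (h : headRed phi (app s a v) = none) : headRed phi (app s a u) = none := by
  cases s with
  | obj l =>
    rw [← Option.not_isSome_iff_eq_none, headRed_app_obj_isSome] at h ⊢
    exact h
  | _ => simp_all [headRed]

theorem Head.nOrds {t s : Tm L} (h : ReflTransGen (Head phi) t s) :
    ReflTransGen (NOrd phi) t s :=
  h.lift id fun _ _ h => nordRed_of_headRed h.headRed_eq

mutual
theorem Std.nOrds : ∀ {t s : Tm L}, Std phi t s → (∀ s', ¬ Step phi s s') →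
    ReflTransGen (NOrd phi) t s
  | _, _, .loc h, _ => Head.nOrds h
  | _, _, .dot h h₁, hs =>
    (Head.nOrds h).trans
      (nOrds_dot (h₁.nOrds fun _ h => hs _ (.congDot _ h)) (headRed_eq_none hs))
  | _, _, .app (s₁ := s₁) (a := a) h h₁ h₂, hs => by
    have h₁n : ∀ s', ¬ Step phi s₁ s' := fun _ h => hs _ (.congAppL _ h)
    have hr := fun u => headRed_app_eq_none_congr (u := u) (headRed_eq_none hs)
    refine (Head.nOrds h).trans
      ((nOrds_app (h₁.nOrds h₁n) (hr _)).trans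
        ((h₂.nOrds fun _ h => hs _ (.congAppR _ h)).lift (Tm.app s₁ a) fun u u' hu => ?_))
    rw [NOrd] at hu
    change nordRed phi _ = some _
    simp [nordRed, hr, nordRed_eq_none h₁n, hu]
  | _, _, .obj h h₁, hs =>
    (Head.nOrds h).trans
      ((h₁.nOrds [] hs).lift Tm.obj fun l l' hl => by simp [NOrd, nordRed, hl])

theorem StdAttrs.nOrds : ∀ {l l' : List (L × Option (Tm L))}, StdAttrs phi l l' →
    ∀ pre : List (L × Option (Tm L)), (∀ s', ¬ Step phi (obj (pre ++ l')) s') →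
      ReflTransGen (fun l l' => nordList phi l = some l') l l'
  | _, _, .nil, _, _ => .refl
  | _, _, .void a h, pre, hs =>
    (h.nOrds (pre ++ [(a, none)]) (by simpa using hs)).lift ((a, none) :: ·)
      fun l l' hl => by
        change nordList phi _ = some _
        simp [nordList, hl]
  | _, _, .attached (t' := t') (l := l) a h₁ h, pre, hs => by
    have h₁n : ∀ s', ¬ Step phi t' s' := fun _ h => hs _ (.congObj _ _ _ h)
    refine ((h₁.nOrds h₁n).lift (fun t => (a, some t) :: l) fun t t' ht => ?_).trans
      ((h.nOrds (pre ++ [(a, some t')]) (by simpa using hs)).lift ((a, some t') :: ·)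
        fun l l' hl => ?_)
    · rw [NOrd] at ht
      change nordList phi _ = some _
      simp [nordList, ht]
    · change nordList phi _ = some _
      simp [nordList, nordRed_eq_none h₁n, hl]
end

end Standardization
end Tm
end PhiCalc

open PhiCalc Tm in
/-- Completeness of normal order evaluation: if `s` is a normal form of `t`
(i.e. `t ⇝* s` and no `⇝` step applies to `s`), then `t ⇝ℓ* s`. -/
theorem normal_order_complete {L : Type} [DecidableEq L] (phi : L) {t s : Tm L}
    (h1 : Relation.ReflTransGen (Step phi) t s) (h2 : ∀ s' : Tm L, ¬ Step phi s s') :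
    Relation.ReflTransGen (NOrd phi) t s := by
  exact (Std.of_steps h1).nOrds h2
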